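/- Let T > 0, K > 0, L > 0, 0 ≤ a < b ≤ L, and set λ_i := K i² π²/L². Let k : [0,T] → ℝ be continuous with k(0) ≠ 0, and let α, α̂ : [0,T] → ℝ be real-analytic on [0,T] with 0 ≤ α(t), α̂(t) ≤ α* < 1 for all t and each satisfying the limit condition of Assumption A. Let (u_{0,i})_{i≥1} be real numbers, not all zero, and let u_i, û_i ∈ C¹([0,T]) satisfy u_i(0) = û_i(0) = u_{0,i}, u_i'(t) + k(t)·D^{α(t)}u_i(t) = −λ_i u_i(t) and û_i'(t) + k(t)·D^{α̂(t)}û_i(t) = −λ_i û_i(t) for t ∈ (0,T]. Assume moreover that for each t ∈ [0,T] there exist C > 0 and r ∈ (0,1) with |u_i(t)| + |û_i(t)| ≤ C·rⁱ for all i, and that ∑_{i=1}^∞ u_i(t)·sin(iπx/L) = ∑_{i=1}^∞ û_i(t)·sin(iπx/L) for all (x,t) ∈ (a,b)×[0,T]. Then α(t) = α̂(t) for all t ∈ [0,T]. -/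

import Mathlib

open Real Set Filter

/-- Variable-order Caputo-type fractional derivative applied to a function with derivative `g'`. -/
noncomputable def caputo (α g' : ℝ → ℝ) (t : ℝ) : ℝ :=
  (1 / Real.Gamma (1 - α t)) * ∫ s in (0:ℝ)..t, g' s * (t - s) ^ (-(α t))

lemma integral_cos_int_mul (k : ℤ) :
    ∫ x in (0:ℝ)..π, Real.cos (k * x) = if k = 0 then π else 0 := by
  split_ifs with h
  · simp [h]
  · have hk : (k : ℝ) ≠ 0 := by exact_mod_cast h
    rw [intervalIntegral.integral_comp_mul_left (fun x => Real.cos x) hk]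
    simp [Real.sin_int_mul_pi]

lemma integral_sin_succ_mul_sin_succ (m n : ℕ) :
    ∫ x in (0:ℝ)..π, Real.sin (((m : ℝ) + 1) * x) * Real.sin (((n : ℝ) + 1) * x)
      = if m = n then π / 2 else 0 := by
  have h1 : ∀ x : ℝ, Real.sin (((m : ℝ) + 1) * x) * Real.sin (((n : ℝ) + 1) * x)
      = (Real.cos (((m - n : ℤ) : ℝ) * x) - Real.cos (((m + n + 2 : ℤ) : ℝ) * x)) / 2 := by
    intro x
    have h2 : ((m - n : ℤ) : ℝ) * x = ((m : ℝ) + 1) * x - ((n : ℝ) + 1) * x := by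
      push_cast; ring
    have h3 : ((m + n + 2 : ℤ) : ℝ) * x = ((m : ℝ) + 1) * x + ((n : ℝ) + 1) * x := by
      push_cast; ring
    rw [h2, h3, Real.cos_sub, Real.cos_add]; ring
  simp_rw [h1]
  rw [intervalIntegral.integral_div, intervalIntegral.integral_sub
    (Continuous.intervalIntegrable (by fun_prop) _ _)
    (Continuous.intervalIntegrable (by fun_prop) _ _),
    integral_cos_int_mul, integral_cos_int_mul,
    if_neg (show ¬((m : ℤ) + n + 2 = 0) by lia)]
  by_cases h : m = n
  · rw [if_pos (show (m : ℤ) - n = 0 by lia), if_pos h, sub_zero]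
  · rw [if_neg (show ¬((m : ℤ) - n = 0) by lia), if_neg h]; simp

lemma Complex.norm_sin_le_exp_abs_im (z : ℂ) : ‖Complex.sin z‖ ≤ Real.exp |z.im| := by
  have h : Complex.sin z = (Complex.exp (-z * Complex.I) - Complex.exp (z * Complex.I))
      * Complex.I / 2 := rfl
  rw [h, norm_div, norm_mul, Complex.norm_I, mul_one, Complex.norm_ofNat,
    div_le_iff₀ two_pos]
  refine (norm_sub_le _ _).trans ?_
  rw [Complex.norm_exp, Complex.norm_exp]
  have h1 : Real.exp (-z * Complex.I).re ≤ Real.exp |z.im| := by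
    gcongr; simpa using le_abs_self z.im
  have h2 : Real.exp (z * Complex.I).re ≤ Real.exp |z.im| := by
    gcongr; simpa using neg_le_abs z.im
  linarith

/-- A sine series with geometrically decaying coefficients which vanishes on a nonempty open
interval has vanishing coefficients. -/
lemma sine_coeff_eq_zero_of_tsum_eq_zero_on_Ioo {c : ℕ → ℝ} {C r a b : ℝ} (hr0 : 0 < r)
    (hr1 : r < 1) (hc : ∀ i, |c i| ≤ C * r ^ (i + 1)) (hab : a < b)
    (h : ∀ x ∈ Ioo a b, ∑' i : ℕ, c i * Real.sin (((i : ℝ) + 1) * x) = 0) (i : ℕ) :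
    c i = 0 := by
  have hC : 0 ≤ C := by
    have h1 := (abs_nonneg _).trans (hc 0)
    exact nonneg_of_mul_nonneg_left h1 (by positivity)
  set δ : ℝ := -Real.log r / 2 with hδ
  have hlog : Real.log r < 0 := Real.log_neg hr0 hr1
  have hδ0 : 0 < δ := by rw [hδ]; linarith
  set ρ : ℝ := r * Real.exp δ with hρ
  have hρ0 : 0 < ρ := by positivity
  have hρ1 : ρ < 1 := by
    have h1 : ρ = Real.exp (Real.log r + δ) := by rw [Real.exp_add, Real.exp_log hr0]
    rw [h1, Real.exp_lt_one_iff]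
    linarith
  have hsum (q : ℝ) (hq0 : 0 < q) (hq1 : q < 1) : Summable fun i : ℕ => C * q ^ (i + 1) :=
    ((summable_nat_add_iff 1).2 (summable_geometric_of_lt_one hq0.le hq1)).mul_left C
  let S : Set ℂ := Complex.im ⁻¹' Ioo (-δ) δ
  have hSo : IsOpen S := isOpen_Ioo.preimage Complex.continuous_im
  have hSc : IsPreconnected S :=
    ((convex_Ioo (-δ) δ).linear_preimage Complex.imLm).isPreconnected
  let F : ℂ → ℂ := fun z => ∑' i : ℕ, (c i : ℂ) * Complex.sin (((i : ℂ) + 1) * z)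
  have hFd : DifferentiableOn ℂ F S := by
    refine Complex.differentiableOn_tsum_of_summable_norm (hsum ρ hρ0 hρ1) (fun j => ?_) hSo ?_
    · exact Differentiable.differentiableOn (by fun_prop)
    · intro j w hw
      have hw' : |w.im| ≤ δ := abs_le.2 ⟨hw.1.le, hw.2.le⟩
      rw [norm_mul, Complex.norm_real, Real.norm_eq_abs, hρ, mul_pow, ← mul_assoc]
      refine mul_le_mul (hc j) ?_ (norm_nonneg _) (by positivity)
      refine (Complex.norm_sin_le_exp_abs_im _).trans ?_
      rw [← Real.exp_nat_mul]
      gcongr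
      have : (((j : ℂ) + 1) * w).im = ((j : ℝ) + 1) * w.im := by simp
      rw [this, abs_mul, abs_of_pos (by positivity)]
      push_cast
      gcongr
  have hFr (y : ℝ) : F y = ((∑' i : ℕ, c i * Real.sin (((i : ℝ) + 1) * y) : ℝ) : ℂ) := by
    simp only [F]
    rw [Complex.ofReal_tsum]
    push_cast
    rfl
  have hF0 : EqOn F 0 S := by
    obtain ⟨x₀, hx₀⟩ := exists_between hab
    have hFan := (Complex.analyticOnNhd_iff_differentiableOn hSo).2 hFd
    refine hFan.eqOn_zero_of_preconnected_of_frequently_eq_zero hSc (z₀ := (x₀ : ℂ))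
      (by simp [S, hδ0]) ?_
    have hev : ∀ᶠ x in nhdsWithin x₀ {x₀}ᶜ, F ((x : ℝ) : ℂ) = 0 := by
      filter_upwards [mem_nhdsWithin_of_mem_nhds (Ioo_mem_nhds hx₀.1 hx₀.2)] with x hx
      rw [hFr, h x hx, Complex.ofReal_zero]
    have ht : Tendsto (fun x : ℝ => (x : ℂ)) (nhdsWithin x₀ {x₀}ᶜ)
        (nhdsWithin (x₀ : ℂ) {(x₀ : ℂ)}ᶜ) := by
      refine tendsto_nhdsWithin_iff.2 ⟨?_, ?_⟩
      · exact (Complex.continuous_ofReal.tendsto x₀).mono_left nhdsWithin_le_nhds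
      · filter_upwards [self_mem_nhdsWithin] with x hx
        simpa using hx
    exact ht.frequently hev.frequently
  have hreal (y : ℝ) : ∑' i : ℕ, c i * Real.sin (((i : ℝ) + 1) * y) = 0 := by
    have h1 : F y = 0 := hF0 (by simp [S, hδ0])
    rw [hFr] at h1
    exact_mod_cast h1
  have hterm (j : ℕ) (y : ℝ) : |c j * Real.sin (((j : ℝ) + 1) * y)| ≤ C * r ^ (j + 1) := by
    rw [abs_mul]
    exact (mul_le_of_le_one_right (abs_nonneg _) (Real.abs_sin_le_one _)).trans (hc j)
  have hint := intervalIntegral.hasSum_integral_of_dominated_convergence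
    (μ := MeasureTheory.volume) (a := 0) (b := π)
    (F := fun j y => c j * Real.sin (((j : ℝ) + 1) * y) * Real.sin (((i : ℝ) + 1) * y))
    (f := fun _ => 0) (fun j _ => C * r ^ (j + 1))
    (fun j => Continuous.aestronglyMeasurable (by fun_prop))
    (fun j => .of_forall fun y _ => by
      rw [Real.norm_eq_abs, abs_mul]
      exact (mul_le_of_le_one_right (abs_nonneg _) (Real.abs_sin_le_one _)).trans (hterm j y))
    (.of_forall fun _ _ => hsum r hr0 hr1) (by simp)
    (.of_forall fun y _ => by
      have h1 : Summable fun j : ℕ => c j * Real.sin (((j : ℝ) + 1) * y) :=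
        Summable.of_norm_bounded (hsum r hr0 hr1) fun j => hterm j y
      simpa [hreal y] using h1.hasSum.mul_right (Real.sin (((i : ℝ) + 1) * y)))
  simp_rw [mul_assoc, intervalIntegral.integral_const_mul, integral_sin_succ_mul_sin_succ] at hint
  have h2 : HasSum (fun j => c j * if j = i then π / 2 else 0) (c i * (π / 2)) := by
    convert! hasSum_single i (f := fun j => c j * if j = i then π / 2 else 0) ?_ using 1
    · simp
    · intro j hj; simp [hj]
  have h3 := h2.unique hint
  simpa [Real.pi_ne_zero] using h3

/-- Two sine series with geometrically decaying coefficients which agree on a nonempty open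
interval have the same coefficients. -/
lemma sine_coeff_eq_of_tsum_eq_on_Ioo {c d : ℕ → ℝ} {C r L a b : ℝ} (hr0 : 0 < r) (hr1 : r < 1)
    (hL : 0 < L) (hab : a < b) (hcd : ∀ i, |c i| + |d i| ≤ C * r ^ (i + 1))
    (h : ∀ x ∈ Ioo a b, (∑' i : ℕ, c i * Real.sin (((i : ℝ) + 1) * π * x / L))
      = ∑' i : ℕ, d i * Real.sin (((i : ℝ) + 1) * π * x / L)) (i : ℕ) :
    c i = d i := by
  have hsum : Summable fun i : ℕ => C * r ^ (i + 1) :=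
    ((summable_nat_add_iff 1).2 (summable_geometric_of_lt_one hr0.le hr1)).mul_left C
  have hs (e : ℕ → ℝ) (he : ∀ j, |e j| ≤ C * r ^ (j + 1)) (x : ℝ) :
      Summable fun j : ℕ => e j * Real.sin (((j : ℝ) + 1) * π * x / L) := by
    refine Summable.of_norm_bounded hsum fun j => ?_
    rw [Real.norm_eq_abs, abs_mul]
    exact (mul_le_of_le_one_right (abs_nonneg _) (Real.abs_sin_le_one _)).trans (he j)
  have hpL : 0 < π / L := div_pos Real.pi_pos hL
  refine sub_eq_zero.1 (sine_coeff_eq_zero_of_tsum_eq_zero_on_Ioo (c := fun i => c i - d i) hr0 hr1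
    (fun j => (abs_sub _ _).trans (hcd j)) (mul_lt_mul_of_pos_left hab hpL) (fun y hy => ?_) i)
  set x := y / (π / L) with hx
  have hxab : x ∈ Ioo a b :=
    ⟨(lt_div_iff₀' hpL).2 hy.1, (div_lt_iff₀' hpL).2 hy.2⟩
  have hxy (j : ℕ) : ((j : ℝ) + 1) * y = ((j : ℝ) + 1) * π * x / L := by
    rw [hx]; field_simp
  simp_rw [hxy, sub_mul]
  rw [(hs c (fun j => by linarith [hcd j, abs_nonneg (d j)]) x).tsum_sub
    (hs d (fun j => by linarith [hcd j, abs_nonneg (c j)]) x), h x hxab, sub_self]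

/-- The convolution kernel of the Caputo derivative of order `p`. -/
noncomputable def caputoKernel (p τ : ℝ) : ℝ := τ ^ (-p) / Real.Gamma (1 - p)

lemma caputo_eq_integral_caputoKernel (α g : ℝ → ℝ) (t : ℝ) :
    caputo α g t = ∫ s in (0:ℝ)..t, g s * caputoKernel (α t) (t - s) := by
  rw [caputo, ← intervalIntegral.integral_const_mul]
  congr 1 with s
  rw [caputoKernel]
  ring

lemma caputoKernel_nonneg {p τ : ℝ} (hp : p < 1) (hτ : 0 ≤ τ) : 0 ≤ caputoKernel p τ :=
  div_nonneg (Real.rpow_nonneg hτ _) (Real.Gamma_pos_of_pos (sub_pos.2 hp)).le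

/-- Near zero, the Caputo kernel is strictly increasing in the order. -/
lemma exists_caputoKernel_lt {q₀ : ℝ} (hq₀ : q₀ < 1) :
    ∃ δ > 0, ∀ τ, 0 < τ → τ < δ → ∀ p q, p < q → q ≤ q₀ →
      caputoKernel p τ < caputoKernel q τ := by
  set f : ℝ → ℝ := Real.log ∘ Real.Gamma with hf
  have hconv : ConvexOn ℝ (Ioi 0) f := Real.convexOn_log_Gamma
  set z₁ := (1 - q₀) / 3 with hz₁
  set z₂ := (1 - q₀) / 2 with hz₂
  refine ⟨Real.exp ((f z₂ - f z₁) / (z₂ - z₁)), Real.exp_pos _, fun τ hτ hτδ p q hpq hq => ?_⟩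
  have hlog := (Real.log_lt_iff_lt_exp hτ).2 hτδ
  have hx : (0 : ℝ) < 1 - q := by linarith
  have hy : (0 : ℝ) < 1 - p := by linarith
  have h1 := hconv.slope_mono_adjacent (x := z₁) (y := z₂) (z := 1 - q)
    (by simp only [mem_Ioi]; linarith) hx (by linarith) (by linarith)
  have h2 := hconv.slope_mono_adjacent (x := z₂) (y := 1 - q) (z := 1 - p)
    (by simp only [mem_Ioi]; linarith) hy (by linarith) (by linarith)
  have h3 := hlog.trans_le (h1.trans h2)
  rw [lt_div_iff₀ (by linarith)] at h3
  have key (r : ℝ) (hr : 0 < 1 - r) :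
      caputoKernel r τ = Real.exp (Real.log τ * -r - f (1 - r)) := by
    rw [caputoKernel, Real.exp_sub, Real.rpow_def_of_pos hτ, hf, Function.comp_apply,
      Real.exp_log (Real.Gamma_pos_of_pos hr)]
  rw [key p hy, key q hx, Real.exp_lt_exp]
  linarith

lemma intervalIntegrable_mul_caputoKernel {g : ℝ → ℝ} {p t : ℝ} (hp : p < 1) (ht : 0 ≤ t)
    (hg : ContinuousOn g (Icc 0 t)) :
    IntervalIntegrable (fun s => g s * caputoKernel p (t - s)) MeasureTheory.volume 0 t := by
  have h1 : IntervalIntegrable (fun τ : ℝ => τ ^ (-p)) MeasureTheory.volume 0 t :=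
    intervalIntegral.intervalIntegrable_rpow' (by linarith)
  have h2 := (h1.comp_sub_left t).symm
  rw [sub_self, sub_zero] at h2
  exact (h2.div_const _).continuousOn_mul (by rwa [uIcc_of_le ht])

lemma integral_caputoKernel {p : ℝ} (hp : p < 1) (t : ℝ) :
    ∫ s in (0:ℝ)..t, caputoKernel p (t - s) = t ^ (1 - p) / ((1 - p) * Real.Gamma (1 - p)) := by
  rw [intervalIntegral.integral_comp_sub_left (fun τ => caputoKernel p τ) t]
  simp only [caputoKernel, sub_self, sub_zero]
  rw [intervalIntegral.integral_div, integral_rpow (Or.inl (by linarith)),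
    Real.zero_rpow (by linarith), sub_zero, div_div, neg_add_eq_sub]

/-- The Caputo derivative of a `C¹` function vanishes at time zero. -/
lemma tendsto_caputo_nhdsGT_zero {g α : ℝ → ℝ} {T q₀ : ℝ} (hT : 0 < T) (hq₀ : q₀ < 1)
    (hg : ContinuousOn g (Icc 0 T)) (hα : ∀ t ∈ Icc 0 T, α t ≤ q₀) :
    Tendsto (caputo α g) (nhdsWithin 0 (Ioi 0)) (nhds 0) := by
  obtain ⟨M, hM⟩ := isCompact_Icc.exists_bound_of_continuousOn hg
  obtain ⟨δ, hδ, hker⟩ := exists_caputoKernel_lt hq₀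
  have hlim : Tendsto
      (fun t : ℝ => M * (t ^ (1 - q₀) / ((1 - q₀) * Real.Gamma (1 - q₀))))
      (nhdsWithin 0 (Ioi 0)) (nhds 0) := by
    have h1 : ContinuousAt
        (fun t : ℝ => M * (t ^ (1 - q₀) / ((1 - q₀) * Real.Gamma (1 - q₀)))) 0 :=
      (((Real.continuousAt_rpow_const 0 (1 - q₀) (Or.inr (by linarith))).div_const _).const_mul M)
    have h2 := h1.tendsto
    rw [Real.zero_rpow (by linarith), zero_div, mul_zero] at h2
    exact h2.mono_left nhdsWithin_le_nhds
  refine squeeze_zero_norm' ?_ hlim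
  filter_upwards [Ioo_mem_nhdsGT (lt_min hδ hT)] with t ht
  have htT : t ∈ Icc 0 T := ⟨ht.1.le, (ht.2.trans_le (min_le_right _ _)).le⟩
  have hM0 : 0 ≤ M := (norm_nonneg _).trans (hM t htT)
  rw [← integral_caputoKernel hq₀, ← intervalIntegral.integral_const_mul,
    caputo_eq_integral_caputoKernel]
  refine intervalIntegral.norm_integral_le_of_norm_le ht.1.le ?_
    (intervalIntegrable_mul_caputoKernel hq₀ ht.1.le continuousOn_const)
  filter_upwards [MeasureTheory.compl_mem_ae_iff.2 (MeasureTheory.measure_singleton t)]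
    with s hst hs
  have hs0 : 0 < t - s := sub_pos.2 (lt_of_le_of_ne hs.2 hst)
  have hsδ : t - s < δ := by linarith [hs.1, ht.2, min_le_left δ T]
  have hαt := hα t htT
  rw [norm_mul, Real.norm_of_nonneg (caputoKernel_nonneg (hαt.trans_lt hq₀) hs0.le)]
  refine mul_le_mul (hM s ⟨hs.1.le, hs.2.trans htT.2⟩) ?_
    (caputoKernel_nonneg (hαt.trans_lt hq₀) hs0.le) hM0
  rcases hαt.eq_or_lt with h | h
  · rw [h]
  · exact (hker _ hs0 hsδ _ _ h le_rfl).le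

/-- If `g 0 ≠ 0`, the integral of `g` against the Caputo kernel determines the order for small
times. -/
lemma eventually_order_eq_of_integral_caputoKernel_eq {g : ℝ → ℝ} {T q₀ : ℝ} (hT : 0 < T)
    (hq₀ : q₀ < 1) (hg : ContinuousOn g (Icc 0 T)) (hg0 : g 0 ≠ 0) :
    ∀ᶠ t in nhdsWithin 0 (Ioi 0), ∀ p q, p ≤ q₀ → q ≤ q₀ →
      ∫ s in (0:ℝ)..t, g s * caputoKernel p (t - s)
        = ∫ s in (0:ℝ)..t, g s * caputoKernel q (t - s) → p = q := by
  obtain ⟨δ, hδ, hker⟩ := exists_caputoKernel_lt hq₀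
  have hpos : ∀ᶠ s in nhdsWithin 0 (Ioi 0), 0 < g 0 * g s := by
    have h1 : Tendsto (fun s => g 0 * g s) (nhdsWithin 0 (Icc 0 T)) (nhds (g 0 * g 0)) :=
      (hg 0 ⟨le_rfl, hT.le⟩).const_mul (g 0)
    rw [← nhdsWithin_Ioo_eq_nhdsGT hT]
    exact nhdsWithin_mono _ Ioo_subset_Icc_self
      (h1.eventually (lt_mem_nhds (mul_self_pos.2 hg0)))
  obtain ⟨η, hη, hηpos⟩ := mem_nhdsGT_iff_exists_Ioo_subset.1 hpos
  filter_upwards [Ioo_mem_nhdsGT (lt_min (lt_min hδ hT) hη)] with t ht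
  have htδ : t < δ := by linarith [ht.2, min_le_left (min δ T) η, min_le_left δ T]
  have htT : t < T := by linarith [ht.2, min_le_left (min δ T) η, min_le_right δ T]
  have htη : t < η := by linarith [ht.2, min_le_right (min δ T) η]
  have hgt : ContinuousOn g (Icc 0 t) := hg.mono (Icc_subset_Icc_right htT.le)
  have hne (p q : ℝ) (hpq : p < q) (hq : q ≤ q₀) :
      ∫ s in (0:ℝ)..t, g s * caputoKernel p (t - s)
        ≠ ∫ s in (0:ℝ)..t, g s * caputoKernel q (t - s) := by
    intro h
    have hp1 := intervalIntegrable_mul_caputoKernel (p := p) (by linarith) ht.1.le hgt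
    have hq1 := intervalIntegrable_mul_caputoKernel (p := q) (by linarith) ht.1.le hgt
    have h1 := intervalIntegral.intervalIntegral_pos_of_pos_on ((hq1.sub hp1).const_mul (g 0))
      (fun s hs => by
        have h2 := hker (t - s) (by linarith [hs.2]) (by linarith [hs.1]) p q hpq hq
        have h3 : 0 < g 0 * g s := hηpos ⟨hs.1, hs.2.trans htη⟩
        have h4 := mul_pos h3 (sub_pos.2 h2)
        linarith) ht.1
    rw [intervalIntegral.integral_const_mul, intervalIntegral.integral_sub hq1 hp1, h, sub_self,
      mul_zero] at h1
    exact lt_irrefl _ h1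
  intro p q hp hq h
  rcases lt_trichotomy p q with hpq | hpq | hpq
  · exact absurd h (hne p q hpq hq)
  · exact hpq
  · exact absurd h.symm (hne q p hpq hp)

/-- Two functions analytic on `[a, b]` which agree immediately to the right of `a` agree on `[a, b]`. -/
lemma eqOn_Icc_of_analyticOn_of_eventuallyEq_nhdsGT {f g : ℝ → ℝ} {a b : ℝ} (hab : a < b)
    (hf : AnalyticOn ℝ f (Icc a b)) (hg : AnalyticOn ℝ g (Icc a b))
    (hfg : f =ᶠ[nhdsWithin a (Ioi a)] g) : EqOn f g (Icc a b) := by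
  obtain ⟨c, hc, hcfg⟩ := (mem_nhdsGT_iff_exists_Ioo_subset' hab).1 hfg
  have hfo := isOpen_Ioo.analyticOn_iff_analyticOnNhd.1 (hf.mono Ioo_subset_Icc_self)
  have hgo := isOpen_Ioo.analyticOn_iff_analyticOnNhd.1 (hg.mono Ioo_subset_Icc_self)
  obtain ⟨x, hx⟩ := exists_between (lt_min hc hab)
  have hfx : f =ᶠ[nhds x] g := by
    filter_upwards [Ioo_mem_nhds hx.1 (hx.2.trans_le (min_le_left _ _))] with y hy
    exact hcfg hy
  have heq := hfo.eqOn_of_preconnected_of_eventuallyEq hgo isPreconnected_Ioo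
    ⟨hx.1, hx.2.trans_le (min_le_right _ _)⟩ hfx
  exact heq.of_subset_closure hf.continuousOn hg.continuousOn Ioo_subset_Icc_self
    (closure_Ioo hab.ne).ge

/-- Theorem 4.2 of the paper in spectral form: the variable fractional order of the variable-order
time-fractional diffusion equation is uniquely determined by observation of the solution on a
spatial subinterval `(a,b) × [0,T]`. Here `lam i = λ_{i+1} = K (i+1)² π²/L²`, the modes `uᵢ, ûᵢ`
solve the mode equations with orders `α, α̂` respectively and common, not identically zero,
initial data `(u₀ᵢ)`; the geometric decay of the coefficients guarantees analyticity in `x` of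
the sine series, validating the Lemma 4.1 identification step. -/
theorem uniqueness_of_variable_order
    (T K L a b αstar : ℝ)
    (hT : 0 < T) (hK : 0 < K) (hL : 0 < L)
    (ha : 0 ≤ a) (hab : a < b) (hb : b ≤ L)
    (hαstar0 : 0 < αstar) (hαstar1 : αstar < 1)
    (lam : ℕ → ℝ) (hlam : ∀ i, lam i = K * ((i : ℝ) + 1)^2 * π^2 / L^2)
    (k : ℝ → ℝ) (hkcont : ContinuousOn k (Icc 0 T)) (hk0 : k 0 ≠ 0)
    (α αh : ℝ → ℝ)
    (hαan : AnalyticOn ℝ α (Icc 0 T)) (hαhan : AnalyticOn ℝ αh (Icc 0 T))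
    (hαbdd : ∀ t ∈ Icc 0 T, 0 ≤ α t ∧ α t ≤ αstar)
    (hαhbdd : ∀ t ∈ Icc 0 T, 0 ≤ αh t ∧ αh t ≤ αstar)
    (hlim : ∃ ℓ : ℝ, Tendsto (fun t => (α t - α 0) * Real.log t)
      (nhdsWithin 0 (Ioi 0)) (nhds ℓ))
    (hlimh : ∃ ℓ : ℝ, Tendsto (fun t => (αh t - αh 0) * Real.log t)
      (nhdsWithin 0 (Ioi 0)) (nhds ℓ))
    (u₀ : ℕ → ℝ) (hu₀ : ∃ i, u₀ i ≠ 0)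
    (u uh : ℕ → ℝ → ℝ)
    (hu : ∀ i, ContDiffOn ℝ 1 (u i) (Icc 0 T) ∧ u i 0 = u₀ i ∧
      ∀ t ∈ Ioc 0 T,
        derivWithin (u i) (Icc 0 T) t
          + k t * caputo α (derivWithin (u i) (Icc 0 T)) t = -(lam i) * u i t)
    (huh : ∀ i, ContDiffOn ℝ 1 (uh i) (Icc 0 T) ∧ uh i 0 = u₀ i ∧
      ∀ t ∈ Ioc 0 T,
        derivWithin (uh i) (Icc 0 T) t
          + k t * caputo αh (derivWithin (uh i) (Icc 0 T)) t = -(lam i) * uh i t)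
    (hdecay : ∀ t ∈ Icc 0 T, ∃ C r : ℝ, 0 < C ∧ 0 < r ∧ r < 1 ∧
      ∀ i : ℕ, |u i t| + |uh i t| ≤ C * r ^ (i + 1))
    (hobs : ∀ x ∈ Ioo a b, ∀ t ∈ Icc 0 T,
      (∑' i : ℕ, u i t * Real.sin (((i : ℝ) + 1) * π * x / L))
        = ∑' i : ℕ, uh i t * Real.sin (((i : ℝ) + 1) * π * x / L)) :
    ∀ t ∈ Icc 0 T, α t = αh t := by
  obtain ⟨i, hi⟩ := hu₀
  have heq : EqOn (u i) (uh i) (Icc 0 T) := by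
    intro t ht
    obtain ⟨C, r, -, hr0, hr1, hC⟩ := hdecay t ht
    exact sine_coeff_eq_of_tsum_eq_on_Ioo hr0 hr1 hL hab hC (fun x hx => hobs x hx t ht) i
  have hderiv : EqOn (derivWithin (u i) (Icc 0 T)) (derivWithin (uh i) (Icc 0 T)) (Icc 0 T) :=
    fun t ht => derivWithin_congr heq (heq ht)
  obtain ⟨hC1, hu0, hode⟩ := hu i
  obtain ⟨-, -, hodeh⟩ := huh i
  set g := derivWithin (u i) (Icc 0 T) with hgdef
  have hg : ContinuousOn g (Icc 0 T) :=
    hC1.continuousOn_derivWithin (uniqueDiffOn_Icc hT) le_rfl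
  have h0T : (0 : ℝ) ∈ Icc 0 T := ⟨le_rfl, hT.le⟩
  have hle : nhdsWithin (0 : ℝ) (Ioi 0) ≤ nhdsWithin 0 (Icc 0 T) := by
    rw [← nhdsWithin_Ioo_eq_nhdsGT hT]
    exact nhdsWithin_mono _ Ioo_subset_Icc_self
  have hsmall : ∀ᶠ t in nhdsWithin (0 : ℝ) (Ioi 0), t ∈ Ioc 0 T := Ioc_mem_nhdsGT hT
  have hg0 : g 0 = -(lam i) * u₀ i := by
    have h1 : Tendsto (fun t => g t + k t * caputo α g t) (nhdsWithin 0 (Ioi 0))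
        (nhds (g 0 + k 0 * 0)) :=
      ((hg 0 h0T).mono_left hle).add (((hkcont 0 h0T).mono_left hle).mul
        (tendsto_caputo_nhdsGT_zero hT hαstar1 hg fun t ht => (hαbdd t ht).2))
    have h2 : Tendsto (fun t => -(lam i) * u i t) (nhdsWithin 0 (Ioi 0))
        (nhds (-(lam i) * u i 0)) :=
      ((hC1.continuousOn 0 h0T).mono_left hle).const_mul _
    have h3 := tendsto_nhds_unique (h1.congr' (hsmall.mono fun t ht => hode t ht)) h2
    rwa [mul_zero, add_zero, hu0] at h3
  have hlampos : 0 < lam i := by rw [hlam]; positivity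
  have hg0ne : g 0 ≠ 0 := by
    rw [hg0]
    exact mul_ne_zero (neg_ne_zero.2 hlampos.ne') hi
  have hk : ∀ᶠ t in nhdsWithin (0 : ℝ) (Ioi 0), k t ≠ 0 :=
    hle ((hkcont 0 h0T).eventually_ne hk0)
  refine eqOn_Icc_of_analyticOn_of_eventuallyEq_nhdsGT hT hαan hαhan ?_
  filter_upwards [hk, hsmall,
    eventually_order_eq_of_integral_caputoKernel_eq hT hαstar1 hg hg0ne] with t hkt ht hinj
  have htT : t ∈ Icc 0 T := Ioc_subset_Icc_self ht
  have hcap : caputo αh (derivWithin (uh i) (Icc 0 T)) t = caputo αh g t := by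
    rw [caputo, caputo]
    congr 1
    refine intervalIntegral.integral_congr fun s hs => ?_
    rw [uIcc_of_le ht.1.le] at hs
    simp only [hderiv ⟨hs.1, hs.2.trans ht.2⟩]
  have h1 := hode t ht
  have h2 := hodeh t ht
  rw [hcap, ← hderiv htT, ← heq htT, ← h1] at h2
  have h3 := mul_left_cancel₀ hkt (add_left_cancel h2)
  rw [caputo_eq_integral_caputoKernel, caputo_eq_integral_caputoKernel] at h3
  exact hinj _ _ (hαbdd t htT).2 (hαhbdd t htT).2 h3.symm
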